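/- Let φ be an N-function with the good φ' property with constant G, let V(Q) = √(φ'(|Q|)/|Q|)·Q (V(0) = 0) on real symmetric d×d matrices, and let A be a map from symmetric d×d matrices to symmetric d×d matrices satisfying, with fixed constants c₀, C₀ > 0, the Orlicz growth conditions (A(P) − A(Q)):(P − Q) ≥ c₀·φ''(|P|+|Q|)·|P−Q|² and |A(P) − A(Q)| ≤ C₀·φ''(|P|+|Q|)·|P−Q| for all symmetric P, Q with |P|+|Q| > 0. Then there exist constants c, C > 0 depending only on G, c₀, C₀ such that for all such P, Q: c·|V(P) − V(Q)|² ≤ (A(P) − A(Q)):(P − Q) ≤ C·|V(P) − V(Q)|² (equivalence (57) of Proposition 5). -/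

import Mathlib

open MeasureTheory Real Set Filter

noncomputable section

/-- `φ` is an N-function with right-continuous, non-decreasing density `φ'`:
`φ t = ∫₀ᵗ φ'`, `φ'(0) = 0`, `φ' > 0` on `(0,∞)`, `φ'(t) → ∞` as `t → ∞`. -/
def IsNFunction (φ φ' : ℝ → ℝ) : Prop :=
  (∀ t, 0 ≤ t → φ t = ∫ s in (0:ℝ)..t, φ' s) ∧
  (∀ s, 0 ≤ s → 0 ≤ φ' s) ∧
  (∀ s t, 0 ≤ s → s ≤ t → φ' s ≤ φ' t) ∧
  φ' 0 = 0 ∧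
  (∀ t, 0 < t → 0 < φ' t) ∧
  Filter.Tendsto φ' Filter.atTop Filter.atTop ∧
  (∀ t, 0 ≤ t → ContinuousWithinAt φ' (Set.Ici t) t)

/-- The Δ₂ condition with constant `K`: `φ(2t) ≤ K·φ(t)` for all `t ≥ 0`. -/
def Delta2 (φ : ℝ → ℝ) (K : ℝ) : Prop := ∀ t, 0 ≤ t → φ (2 * t) ≤ K * φ t

/-- The complementary (conjugate) function `φ*(t) = sup_{s ≥ 0} (t·s − φ(s))`. -/
def conjFn (φ : ℝ → ℝ) (t : ℝ) : ℝ := sSup {x | ∃ s, 0 ≤ s ∧ x = t * s - φ s}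

/-- The good `φ'` property with constant `G ≥ 1`:
`φ` is `C¹` on `[0,∞)` and `C²` on `(0,∞)` with
`G⁻¹·φ'(t) ≤ t·φ''(t) ≤ G·φ'(t)` for `t > 0`. -/
def GoodPhi (φ φ' φ'' : ℝ → ℝ) (G : ℝ) : Prop :=
  1 ≤ G ∧
  (∀ t, 0 < t → HasDerivAt φ (φ' t) t) ∧
  (∀ t, 0 < t → HasDerivAt φ' (φ'' t) t) ∧
  ContinuousWithinAt φ' (Set.Ici 0) 0 ∧
  (∀ t, 0 < t → ContinuousAt φ'' t) ∧
  (∀ t, 0 < t → G⁻¹ * φ' t ≤ t * φ'' t ∧ t * φ'' t ≤ G * φ' t)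

/-- The square-root N-function `φ̄(t) = ∫₀ᵗ √(s·φ'(s)) ds`. -/
def barPhi (φ' : ℝ → ℝ) (t : ℝ) : ℝ := ∫ s in (0:ℝ)..t, Real.sqrt (s * φ' s)

/-- Derivative of the square-root N-function: `φ̄'(t) = √(t·φ'(t))`. -/
def barPhi' (φ' : ℝ → ℝ) (t : ℝ) : ℝ := Real.sqrt (t * φ' t)

/-- Frobenius inner product `P : Q = ∑ᵢⱼ Pᵢⱼ·Qᵢⱼ`. -/
def minner {d : ℕ} (P Q : Matrix (Fin d) (Fin d) ℝ) : ℝ := ∑ i, ∑ j, P i j * Q i j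

/-- Frobenius norm `|P| = √(P : P)`. -/
def fnorm {d : ℕ} (P : Matrix (Fin d) (Fin d) ℝ) : ℝ := Real.sqrt (minner P P)

/-- The tensor `Q ↦ g(|Q|)·Q/|Q|` (with value `0` at `Q = 0`). -/
def tensorT {d : ℕ} (g : ℝ → ℝ) (Q : Matrix (Fin d) (Fin d) ℝ) :
    Matrix (Fin d) (Fin d) ℝ :=
  if Q = 0 then 0 else (g (fnorm Q) / fnorm Q) • Q


lemma aux_minner_prod {d : ℕ} (P Q : Matrix (Fin d) (Fin d) ℝ) :
    minner P Q = ∑ x : Fin d × Fin d, P x.1 x.2 * Q x.1 x.2 := by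
  rw [minner, Fintype.sum_prod_type]

lemma aux_minner_self_nonneg {d : ℕ} (P : Matrix (Fin d) (Fin d) ℝ) : 0 ≤ minner P P := by
  rw [aux_minner_prod]
  exact Finset.sum_nonneg fun x _ => mul_self_nonneg _

lemma aux_fnorm_nonneg {d : ℕ} (P : Matrix (Fin d) (Fin d) ℝ) : 0 ≤ fnorm P := Real.sqrt_nonneg _

lemma aux_fnorm_sq {d : ℕ} (P : Matrix (Fin d) (Fin d) ℝ) : fnorm P ^ 2 = minner P P :=
  Real.sq_sqrt (aux_minner_self_nonneg P)

lemma aux_cs {d : ℕ} (P Q : Matrix (Fin d) (Fin d) ℝ) : |minner P Q| ≤ fnorm P * fnorm Q := by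
  apply abs_le_of_sq_le_sq _ (mul_nonneg (aux_fnorm_nonneg P) (aux_fnorm_nonneg Q))
  rw [mul_pow, aux_fnorm_sq, aux_fnorm_sq, aux_minner_prod, aux_minner_prod, aux_minner_prod]
  have := Finset.sum_mul_sq_le_sq_mul_sq Finset.univ
    (fun x : Fin d × Fin d => P x.1 x.2) (fun x => Q x.1 x.2)
  simpa [pow_two] using this

lemma aux_expand {d : ℕ} (a b : ℝ) (P Q : Matrix (Fin d) (Fin d) ℝ) :
    fnorm (a • P - b • Q) ^ 2 = a ^ 2 * fnorm P ^ 2 + b ^ 2 * fnorm Q ^ 2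
      - 2 * a * b * minner P Q := by
  simp only [aux_fnorm_sq, aux_minner_prod, Finset.mul_sum]
  rw [← Finset.sum_add_distrib, ← Finset.sum_sub_distrib]
  refine Finset.sum_congr rfl fun x _ => ?_
  simp
  ring

lemma aux_fnorm_comm {d : ℕ} (P Q : Matrix (Fin d) (Fin d) ℝ) : fnorm (P - Q) = fnorm (Q - P) := by
  simp only [fnorm, minner]
  congr 1
  refine Finset.sum_congr rfl fun i _ => Finset.sum_congr rfl fun j _ => ?_
  simp
  ring

lemma aux_tensor {d : ℕ} (g : ℝ → ℝ) (Q : Matrix (Fin d) (Fin d) ℝ) :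
    tensorT g Q = (g (fnorm Q) / fnorm Q) • Q := by
  unfold tensorT
  split_ifs with h
  · simp [h]
  · rfl

/-- the scalar comparison -/
lemma aux_scalar (r h w : ℝ) (N : ℕ) (hr0 : 0 ≤ r) (hr1 : r ≤ 1) (hh0 : 0 ≤ h)
    (hw0 : 0 ≤ w) (hw4 : w ≤ 4) (h1 : r ^ N ≤ h ^ 2) (h2 : h ^ 2 ≤ r) :
    (1 - h) ^ 2 + h * w ≤ ((N:ℝ) ^ 2 + 12) * ((1 - r) ^ 2 + r * w) ∧
    (1 - r) ^ 2 + r * w ≤ (2 ^ N + 36) * ((1 - h) ^ 2 + h * w) := by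
  have hh1 : h ≤ 1 := by nlinarith
  have hrw : 0 ≤ r * w := mul_nonneg hr0 hw0
  have hhw : 0 ≤ h * w := mul_nonneg hh0 hw0
  constructor
  · have hb : 1 - h ≤ N * (1 - r) := by
      have := one_add_mul_le_pow (a := r - 1) (by linarith) N
      have e : 1 + (r - 1) = r := by ring
      rw [e] at this
      nlinarith
    have hb2 : (1 - h) ^ 2 ≤ (N:ℝ) ^ 2 * (1 - r) ^ 2 := by
      rw [← mul_pow]
      exact pow_le_pow_left₀ (by linarith) hb 2
    have hb3 : h * w ≤ 4 * (r * w) + 8 * (1 - r) ^ 2 := by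
      rcases le_or_gt (1/4) r with hr | hr
      · nlinarith [sq_nonneg (1 - r)]
      · have : h * w ≤ 4 := by nlinarith
        nlinarith
    have : 0 ≤ (N:ℝ) ^ 2 * (r * w) := by positivity
    nlinarith [sq_nonneg (1 - r)]
  · have hb : (1 - r) ^ 2 ≤ 4 * (1 - h) ^ 2 := by
      have : 1 - r ≤ 2 * (1 - h) := by nlinarith [sq_nonneg (1 - h)]
      nlinarith
    have hp : (0:ℝ) < 2 ^ N := by positivity
    have hb3 : r * w ≤ 2 ^ N * (h * w) + 32 * (1 - h) ^ 2 := by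
      rcases le_or_gt (1/2) r with hr | hr
      · have a1 : (1/2 : ℝ) ^ N ≤ r ^ N := pow_le_pow_left₀ (by norm_num) hr N
        have a2 : (1/2 : ℝ) ^ N ≤ h := by nlinarith
        have a3 : (1:ℝ) ≤ 2 ^ N * h := by
          calc (1:ℝ) = 2 ^ N * (1/2) ^ N := by rw [← mul_pow]; norm_num
            _ ≤ 2 ^ N * h := by gcongr
        nlinarith [sq_nonneg (1 - h)]
      · have a1 : 1 / 4 ≤ 1 - h := by nlinarith [sq_nonneg (1 - h)]
        have a2 : r * w ≤ 2 := by nlinarith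
        have a3 : 0 ≤ 2 ^ N * (h * w) := by positivity
        nlinarith
    have a3 : 0 ≤ 2 ^ N * (1 - h) ^ 2 := by positivity
    nlinarith

/-- growth of `φ'` -/
lemma aux_growth (φ' φ'' : ℝ → ℝ) (G : ℝ) (n : ℕ) (hn : G ≤ n)
    (hpos : ∀ t, 0 < t → 0 < φ' t)
    (hd : ∀ t, 0 < t → HasDerivAt φ' (φ'' t) t)
    (hG : ∀ t, 0 < t → t * φ'' t ≤ G * φ' t) (s t : ℝ) (hs : 0 < s) (hst : s ≤ t) :
    s ^ n * φ' t ≤ t ^ n * φ' s := by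
  have hder : ∀ x, 0 < x → HasDerivAt (fun x => φ' x / x ^ n)
      ((φ'' x * x ^ n - φ' x * (n * x ^ (n - 1))) / (x ^ n) ^ 2) x := fun x hx =>
    (hd x hx).div (hasDerivAt_pow n x) (by positivity)
  have hanti : AntitoneOn (fun x => φ' x / x ^ n) (Set.Ioi 0) := by
    apply antitoneOn_of_deriv_nonpos (convex_Ioi 0)
    · exact fun x hx => (hder x hx).continuousAt.continuousWithinAt
    · rw [interior_Ioi]
      exact fun x hx => (hder x hx).differentiableAt.differentiableWithinAt
    · rw [interior_Ioi]
      intro x hx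
      have hx : 0 < x := hx
      rw [(hder x hx).deriv]
      apply div_nonpos_of_nonpos_of_nonneg _ (by positivity)
      have h1 : x * φ'' x ≤ n * φ' x := (hG x hx).trans
        (mul_le_mul_of_nonneg_right hn (hpos x hx).le)
      rcases n with _ | m
      · simp at h1 ⊢
        nlinarith
      · have : 0 ≤ x ^ m := by positivity
        simp only [Nat.add_sub_cancel, pow_succ]
        nlinarith
  have ht : 0 < t := hs.trans_le hst
  have := hanti (show s ∈ Set.Ioi 0 from hs) (show t ∈ Set.Ioi 0 from ht) hst
  simp only at this
  rw [div_le_div_iff₀ (by positivity) (by positivity)] at this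
  linarith

set_option maxHeartbeats 1000000 in
lemma aux_key {d : ℕ} (φ' φ'' : ℝ → ℝ) (G : ℝ) (n : ℕ) (hG1 : 1 ≤ G) (hn : G ≤ n)
    (h0 : φ' 0 = 0)
    (hpos : ∀ t, 0 < t → 0 < φ' t)
    (hmono : ∀ s t, 0 ≤ s → s ≤ t → φ' s ≤ φ' t)
    (hd : ∀ t, 0 < t → HasDerivAt φ' (φ'' t) t)
    (hG : ∀ t, 0 < t → G⁻¹ * φ' t ≤ t * φ'' t ∧ t * φ'' t ≤ G * φ' t)
    (P Q : Matrix (Fin d) (Fin d) ℝ) (hp : 0 < fnorm P) (hqp : fnorm Q ≤ fnorm P) :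
    fnorm (tensorT (barPhi' φ') P - tensorT (barPhi' φ') Q) ^ 2 ≤
      (2 * G * (((n + 1 : ℕ) : ℝ) ^ 2 + 12)) *
        (φ'' (fnorm P + fnorm Q) * fnorm (P - Q) ^ 2) ∧
    φ'' (fnorm P + fnorm Q) * fnorm (P - Q) ^ 2 ≤
      (G * 2 ^ n * (2 ^ (n + 1) + 36)) *
        fnorm (tensorT (barPhi' φ') P - tensorT (barPhi' φ') Q) ^ 2 := by
  have hq : 0 ≤ fnorm Q := aux_fnorm_nonneg Q
  have hX := abs_le.1 (aux_cs P Q)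
  have e1 := aux_expand 1 1 P Q
  have e2 := aux_expand (barPhi' φ' (fnorm P) / fnorm P) (barPhi' φ' (fnorm Q) / fnorm Q) P Q
  rw [one_smul, one_smul] at e1
  rw [← aux_tensor, ← aux_tensor] at e2
  rw [e1, e2]
  generalize fnorm P = p at *
  generalize fnorm Q = q at *
  generalize minner P Q = X at *
  clear e1 e2
  -- the angle
  obtain ⟨w, hw0, hw4, rfl⟩ : ∃ w, 0 ≤ w ∧ w ≤ 4 ∧ X = p * q * (1 - w / 2) := by
    rcases hq.eq_or_lt with rfl | hq'
    · exact ⟨0, le_rfl, by norm_num, by linarith⟩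
    · have hpq : 0 < p * q := mul_pos hp hq'
      have a1 : X / (p * q) ≤ 1 := (div_le_one hpq).2 hX.2
      have a2 : -1 ≤ X / (p * q) := by rw [le_div_iff₀ hpq]; linarith
      exact ⟨2 - 2 * (X / (p * q)), by linarith, by linarith, by field_simp; ring⟩
  have hfp := hpos p hp
  have hfq : 0 ≤ φ' q := by rw [← h0]; exact hmono 0 q le_rfl hq
  have hgp : 0 < barPhi' φ' p := Real.sqrt_pos.2 (mul_pos hp hfp)
  have hgq : 0 ≤ barPhi' φ' q := Real.sqrt_nonneg _
  have hgp2 : barPhi' φ' p ^ 2 = p * φ' p := Real.sq_sqrt (mul_pos hp hfp).le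
  have hgq2 : barPhi' φ' q ^ 2 = q * φ' q := Real.sq_sqrt (mul_nonneg hq hfq)
  have hgq0 : q = 0 → barPhi' φ' q = 0 := by rintro rfl; simp [barPhi']
  generalize barPhi' φ' p = a at *
  generalize barPhi' φ' q = b at *
  obtain ⟨r, rfl⟩ : ∃ r, q = r * p := ⟨q / p, by field_simp⟩
  obtain ⟨h, rfl⟩ : ∃ h, b = h * a := ⟨b / a, by field_simp⟩
  have hr0 : 0 ≤ r := by by_contra hc; nlinarith
  have hr1 : r ≤ 1 := by by_contra hc; nlinarith
  have hh0 : 0 ≤ h := by by_contra hc; nlinarith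
  have hrat : r ^ n * φ' p ≤ φ' (r * p) := by
    rcases hr0.eq_or_lt with rfl | hr
    · have : n ≠ 0 := by
        rintro rfl
        simp at hn; linarith
      simp [this, h0]
    · have := aux_growth φ' φ'' G n hn hpos hd (fun t ht => (hG t ht).2) (r * p) p
        (by positivity) hqp
      rw [mul_pow] at this
      have hpn : 0 < p ^ n := by positivity
      nlinarith
  have hle := hmono _ _ hq hqp
  have hh2 : h ^ 2 * φ' p = r * φ' (r * p) := by
    have : p * (h ^ 2 * φ' p) = p * (r * φ' (r * p)) := by
      rw [mul_pow, hgp2] at hgq2; linarith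
    exact mul_left_cancel₀ hp.ne' this
  have k1 : r ^ (n + 1) ≤ h ^ 2 := by
    refine le_of_mul_le_mul_right ?_ hfp
    rw [hh2, pow_succ]
    nlinarith
  have k2 : h ^ 2 ≤ r := by
    refine le_of_mul_le_mul_right ?_ hfp
    rw [hh2]
    nlinarith
  obtain ⟨s1, s2⟩ := aux_scalar r h w (n + 1) hr0 hr1 hh0 hw0 hw4 k1 k2
  have E1 : (1:ℝ) ^ 2 * p ^ 2 + 1 ^ 2 * (r * p) ^ 2 - 2 * 1 * 1 * (p * (r * p) * (1 - w / 2))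
      = p ^ 2 * ((1 - r) ^ 2 + r * w) := by ring
  have E2 : (a / p) ^ 2 * p ^ 2 + (h * a / (r * p)) ^ 2 * (r * p) ^ 2
      - 2 * (a / p) * (h * a / (r * p)) * (p * (r * p) * (1 - w / 2))
      = p * φ' p * ((1 - h) ^ 2 + h * w) := by
    have b1 : a / p * p = a := by field_simp
    have b2 : h * a / (r * p) * (r * p) = h * a := by
      by_cases hz : r * p = 0
      · rw [hgq0 hz, hz]; simp
      · exact div_mul_cancel₀ _ hz
    calc _ = (a / p * p) ^ 2 + (h * a / (r * p) * (r * p)) ^ 2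
          - 2 * (a / p * p) * (h * a / (r * p) * (r * p)) * (1 - w / 2) := by ring
      _ = a ^ 2 * ((1 - h) ^ 2 + h * w) := by rw [b1, b2]; ring
      _ = _ := by rw [hgp2]
  rw [E1, E2]
  have hR : 0 ≤ (1 - r) ^ 2 + r * w := by positivity
  have hH : 0 ≤ (1 - h) ^ 2 + h * w := by positivity
  generalize (1 - r) ^ 2 + r * w = R at *
  generalize (1 - h) ^ 2 + h * w = H at *
  have hs : 0 < p + r * p := by linarith
  obtain ⟨g1, g2⟩ := hG _ hs
  have hup : φ' (p + r * p) ≤ 2 ^ n * φ' p := by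
    have := aux_growth φ' φ'' G n hn hpos hd (fun t ht => (hG t ht).2) p (p + r * p) hp
        (by linarith)
    have l : (p + r * p) ^ n ≤ (2 * p) ^ n := pow_le_pow_left₀ hs.le (by linarith) n
    rw [mul_pow] at l
    have hpn : 0 < p ^ n := by positivity
    refine le_of_mul_le_mul_left ?_ hpn
    have l2 := mul_le_mul_of_nonneg_right l hfp.le
    linarith
  have hlo : φ' p ≤ φ' (p + r * p) := hmono _ _ hp.le (by linarith)
  have hG0 : 0 < G := by linarith
  have hf2 : 0 ≤ φ'' (p + r * p) := by
    have : 0 ≤ G⁻¹ * φ' (p + r * p) := by have := hpos _ hs; positivity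
    exact nonneg_of_mul_nonneg_right (this.trans g1) hs
  have m1 : φ' p ≤ 2 * G * (p * φ'' (p + r * p)) := by
    have : φ' (p + r * p) ≤ G * ((p + r * p) * φ'' (p + r * p)) := by
      rwa [inv_mul_le_iff₀ hG0] at g1
    have : (p + r * p) * φ'' (p + r * p) ≤ 2 * p * φ'' (p + r * p) := by
      apply mul_le_mul_of_nonneg_right _ hf2; linarith
    have l2 := mul_le_mul_of_nonneg_left this hG0.le
    linarith
  have m2 : p * φ'' (p + r * p) ≤ G * 2 ^ n * φ' p := by
    have : p * φ'' (p + r * p) ≤ (p + r * p) * φ'' (p + r * p) := by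
      apply mul_le_mul_of_nonneg_right _ hf2; linarith
    have l2 := mul_le_mul_of_nonneg_left hup hG0.le
    linarith
  constructor
  · calc p * φ' p * H ≤ p * (2 * G * (p * φ'' (p + r * p))) *
          ((((n + 1 : ℕ) : ℝ) ^ 2 + 12) * R) := by gcongr
      _ = _ := by ring
  · calc φ'' (p + r * p) * (p ^ 2 * R) = p * (p * φ'' (p + r * p)) * R := by ring
      _ ≤ p * (G * 2 ^ n * φ' p) * ((2 ^ (n + 1) + 36) * H) := by gcongr
      _ = _ := by ring

/-- Equivalence (57): for a tensor `A` with Orlicz growth (Assumption 1),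
`(A(P) − A(Q)) : (P − Q) ∼ |V(P) − V(Q)|²` with constants depending only on
`G, c₀, C₀`. -/
theorem tensor_equiv_V :
    ∃ c C : ℝ → ℝ → ℝ → ℝ, ∀ (G c₀ C₀ : ℝ) (d : ℕ) (φ φ' φ'' : ℝ → ℝ)
      (A : Matrix (Fin d) (Fin d) ℝ → Matrix (Fin d) (Fin d) ℝ),
      IsNFunction φ φ' → GoodPhi φ φ' φ'' G → 0 < c₀ → 0 < C₀ →
      (∀ P Q : Matrix (Fin d) (Fin d) ℝ, P.IsSymm → Q.IsSymm →
        0 < fnorm P + fnorm Q →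
        c₀ * φ'' (fnorm P + fnorm Q) * fnorm (P - Q) ^ 2 ≤
          minner (A P - A Q) (P - Q) ∧
        fnorm (A P - A Q) ≤ C₀ * φ'' (fnorm P + fnorm Q) * fnorm (P - Q)) →
      0 < c G c₀ C₀ ∧ 0 < C G c₀ C₀ ∧
      ∀ P Q : Matrix (Fin d) (Fin d) ℝ, P.IsSymm → Q.IsSymm →
        0 < fnorm P + fnorm Q →
        c G c₀ C₀ * fnorm (tensorT (barPhi' φ') P - tensorT (barPhi' φ') Q) ^ 2 ≤
          minner (A P - A Q) (P - Q) ∧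
        minner (A P - A Q) (P - Q) ≤
          C G c₀ C₀ * fnorm (tensorT (barPhi' φ') P - tensorT (barPhi' φ') Q) ^ 2 := by
  refine ⟨fun G c₀ _ => c₀ / (2 * G * (((⌈G⌉₊ + 1 : ℕ) : ℝ) ^ 2 + 12)),
    fun G _ C₀ => C₀ * (G * 2 ^ ⌈G⌉₊ * (2 ^ (⌈G⌉₊ + 1) + 36)), ?_⟩
  intro G c₀ C₀ d φ φ' φ'' A hN hg hc hC hA
  obtain ⟨-, -, hmono, h0, hpos, -, -⟩ := hN
  obtain ⟨hG1, -, hd, -, -, hG⟩ := hg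
  have hG0 : 0 < G := by linarith
  refine ⟨by positivity, by positivity, ?_⟩
  intro P Q hP hQ hPQ
  obtain ⟨a1, a2⟩ := hA P Q hP hQ hPQ
  have key : fnorm (tensorT (barPhi' φ') P - tensorT (barPhi' φ') Q) ^ 2 ≤
      (2 * G * (((⌈G⌉₊ + 1 : ℕ) : ℝ) ^ 2 + 12)) *
        (φ'' (fnorm P + fnorm Q) * fnorm (P - Q) ^ 2) ∧
    φ'' (fnorm P + fnorm Q) * fnorm (P - Q) ^ 2 ≤
      (G * 2 ^ ⌈G⌉₊ * (2 ^ (⌈G⌉₊ + 1) + 36)) *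
        fnorm (tensorT (barPhi' φ') P - tensorT (barPhi' φ') Q) ^ 2 := by
    rcases le_total (fnorm Q) (fnorm P) with h | h
    · exact aux_key φ' φ'' G _ hG1 (Nat.le_ceil G) h0 hpos hmono hd hG P Q (by linarith) h
    · rw [aux_fnorm_comm P Q, add_comm (fnorm P), aux_fnorm_comm (tensorT _ P)]
      exact aux_key φ' φ'' G _ hG1 (Nat.le_ceil G) h0 hpos hmono hd hG Q P (by linarith) h
  obtain ⟨k1, k2⟩ := key
  constructor
  · refine le_trans ?_ a1
    rw [div_mul_eq_mul_div, div_le_iff₀ (by positivity)]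
    calc _ ≤ c₀ * ((2 * G * (((⌈G⌉₊ + 1 : ℕ) : ℝ) ^ 2 + 12)) *
        (φ'' (fnorm P + fnorm Q) * fnorm (P - Q) ^ 2)) := mul_le_mul_of_nonneg_left k1 hc.le
      _ = _ := by ring
  · calc minner (A P - A Q) (P - Q) ≤ fnorm (A P - A Q) * fnorm (P - Q) :=
          (le_abs_self _).trans (aux_cs _ _)
      _ ≤ C₀ * φ'' (fnorm P + fnorm Q) * fnorm (P - Q) * fnorm (P - Q) :=
          mul_le_mul_of_nonneg_right a2 (aux_fnorm_nonneg _)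
      _ = C₀ * (φ'' (fnorm P + fnorm Q) * fnorm (P - Q) ^ 2) := by ring
      _ ≤ C₀ * ((G * 2 ^ ⌈G⌉₊ * (2 ^ (⌈G⌉₊ + 1) + 36)) *
        fnorm (tensorT (barPhi' φ') P - tensorT (barPhi' φ') Q) ^ 2) :=
          mul_le_mul_of_nonneg_left k2 hC.le
      _ = _ := by ring
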